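/- Let M be a spacelike surface in ℝ^{3,1} with a canonical normal null direction Z. Then the Gauss curvature and the normal curvature of M are given by the exterior derivatives K = −dα(Z^⊤, W) and K_N = dβ(Z^⊤, W), where dω(X,Y) = X(ω(Y)) − Y(ω(X)) − ω([X,Y]) for a 1-form ω. -/

import Mathlib

noncomputable section

/-- Points of the parameter domain of the surface chart. -/
abbrev Pt : Type := ℝ × ℝ

/-- Vectors of the Minkowski space `ℝ^{3,1}`. -/
abbrev E4 : Type := Fin 4 → ℝ

/-- The Minkowski bilinear form of signature `(+,+,+,-)` on `ℝ⁴`. -/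
def mink (v w : E4) : ℝ := v 0 * w 0 + v 1 * w 1 + v 2 * w 2 - v 3 * w 3

/-- Realization in `ℝ^{3,1}` of a coordinate vector field `X` along the immersion `ψ`. -/
def vecF (ψ : Pt → E4) (X : Pt → Pt) : Pt → E4 := fun p => fderiv ℝ ψ p (X p)

/-- Flat (ambient) derivative of an `ℝ⁴`-valued field along a coordinate vector field. -/
def Dflat (X : Pt → Pt) (V : Pt → E4) : Pt → E4 := fun p => fderiv ℝ V p (X p)

/-- Second fundamental form `B(X,Y) = ∇̄_X Y − ∇_X Y`. -/
def sff (ψ : Pt → E4) (conn : (Pt → Pt) → (Pt → Pt) → Pt → Pt) (X Y : Pt → Pt) : Pt → E4 :=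
  fun p => Dflat X (vecF ψ Y) p - vecF ψ (conn X Y) p

/-- `v` is tangent to the surface at `p`. -/
def isTangentV (ψ : Pt → E4) (p : Pt) (v : E4) : Prop := ∃ w : Pt, fderiv ℝ ψ p w = v

/-- `v` is normal to the surface at `p`. -/
def isNormalV (ψ : Pt → E4) (p : Pt) (v : E4) : Prop := ∀ w : Pt, mink v (fderiv ℝ ψ p w) = 0

/-- Lie bracket of coordinate vector fields on the chart. -/
def lieB (X Y : Pt → Pt) : Pt → Pt := fun p => fderiv ℝ Y p (X p) - fderiv ℝ X p (Y p)

/-- Curvature tensor `R(X,Y)V = ∇_Y∇_X V − ∇_X∇_Y V + ∇_{[X,Y]}V`. -/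
def curvR (conn : (Pt → Pt) → (Pt → Pt) → Pt → Pt) (X Y V : Pt → Pt) : Pt → Pt :=
  fun p => conn Y (conn X V) p - conn X (conn Y V) p + conn (lieB X Y) V p

/-- Normal curvature tensor `R^⊥(X,Y)ν = ∇⊥_Y∇⊥_X ν − ∇⊥_X∇⊥_Y ν + ∇⊥_{[X,Y]}ν`. -/
def curvRperp (nconn : (Pt → Pt) → (Pt → E4) → Pt → E4) (X Y : Pt → Pt) (ν : Pt → E4) :
    Pt → E4 :=
  fun p => nconn Y (nconn X ν) p - nconn X (nconn Y ν) p + nconn (lieB X Y) ν p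

/-- Determinant of four vectors of `ℝ⁴` (the volume form `e₁∧e₂∧e₃∧e₄ ↦ 1`). -/
def det4 (a b c d : E4) : ℝ := Matrix.det (Matrix.of ![a, b, c, d])

/-- A spacelike surface in `ℝ^{3,1}`, given by a chart `ψ : U → ℝ^{3,1}`, endowed with a
canonical normal null direction with respect to the constant unit spacelike vector `Z`,
together with all the associated geometric data: the Levi-Civita connection `conn`,
the normal connection `nconn`, the tangent part `Z^⊤` (coordinates `ZT`), the oriented
orthonormal completion `W` (coordinates `Wc`), the shape operator `shA = A_{Z^⊥}`,
the 1-form `β` with `B(X,Z^⊤) = β(X)Z^⊥`, and the lightlike normal field `W'` with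
`⟨Z^⊥,W'⟩ = 1`.  Each piece of data is characterized by its defining property. -/
structure CNND where
  U : Set Pt
  hUopen : IsOpen U
  ψ : Pt → E4
  hψ : ContDiffOn ℝ (⊤ : ℕ∞) ψ U
  himm : ∀ p ∈ U, ∀ v : Pt, fderiv ℝ ψ p v = 0 → v = 0
  hspacelike : ∀ p ∈ U, ∀ v : Pt, v ≠ 0 → 0 < mink (fderiv ℝ ψ p v) (fderiv ℝ ψ p v)
  /-- Levi-Civita connection of the induced metric, as the tangent part of the flat one. -/
  conn : (Pt → Pt) → (Pt → Pt) → Pt → Pt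
  hconn : ∀ X Y, ∀ p ∈ U, DifferentiableAt ℝ (vecF ψ Y) p → isNormalV ψ p (sff ψ conn X Y p)
  hconnSmooth : ∀ X Y, ContDiffOn ℝ (⊤ : ℕ∞) X U → ContDiffOn ℝ (⊤ : ℕ∞) Y U → ContDiffOn ℝ (⊤ : ℕ∞) (conn X Y) U
  /-- Normal connection: the normal part of the flat derivative of a normal field. -/
  nconn : (Pt → Pt) → (Pt → E4) → Pt → E4
  hnconn : ∀ X ν, ∀ p ∈ U, (∀ q ∈ U, isNormalV ψ q (ν q)) → DifferentiableAt ℝ ν p →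
    isNormalV ψ p (nconn X ν p) ∧ isTangentV ψ p (Dflat X ν p - nconn X ν p)
  hnconnSmooth : ∀ X ν, ContDiffOn ℝ (⊤ : ℕ∞) X U → (∀ q ∈ U, isNormalV ψ q (ν q)) →
    ContDiffOn ℝ (⊤ : ℕ∞) ν U → ContDiffOn ℝ (⊤ : ℕ∞) (nconn X ν) U
  /-- The parallel (constant) vector field `Z`, a unit spacelike vector. -/
  Z : E4
  hZunit : mink Z Z = 1
  /-- Coordinates of the tangent part `Z^⊤` of `Z`; `Z^⊥ = Z − Z^⊤` is normal. -/
  ZT : Pt → Pt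
  hZTsmooth : ContDiffOn ℝ (⊤ : ℕ∞) ZT U
  hZTtangentpart : ∀ p ∈ U, isNormalV ψ p (Z - fderiv ℝ ψ p (ZT p))
  /-- canonical normal null direction: `Z^⊥` is lightlike … -/
  hZperpNull : ∀ p ∈ U, mink (Z - fderiv ℝ ψ p (ZT p)) (Z - fderiv ℝ ψ p (ZT p)) = 0
  /-- … and nowhere zero. -/
  hZperpNe : ∀ p ∈ U, Z - fderiv ℝ ψ p (ZT p) ≠ 0
  /-- Coordinates of the unit tangent field `W` orthogonal to `Z^⊤`, positively oriented. -/
  Wc : Pt → Pt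
  hWsmooth : ContDiffOn ℝ (⊤ : ℕ∞) Wc U
  hWunit : ∀ p ∈ U, mink (fderiv ℝ ψ p (Wc p)) (fderiv ℝ ψ p (Wc p)) = 1
  hWorth : ∀ p ∈ U, mink (fderiv ℝ ψ p (ZT p)) (fderiv ℝ ψ p (Wc p)) = 0
  hWorient : ∀ p ∈ U, 0 < (ZT p).1 * (Wc p).2 - (ZT p).2 * (Wc p).1
  /-- The shape operator `A_{Z^⊥}`: `⟨A_{Z^⊥}X, Y⟩ = ⟨B(X,Y), Z^⊥⟩`. -/
  shA : (Pt → Pt) → Pt → Pt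
  hshA : ∀ X Y, ∀ p ∈ U, DifferentiableAt ℝ (vecF ψ Y) p →
    mink (fderiv ℝ ψ p (shA X p)) (fderiv ℝ ψ p (Y p)) =
      mink (sff ψ conn X Y p) (Z - fderiv ℝ ψ p (ZT p))
  /-- The 1-form `β` with `B(X, Z^⊤) = β(X) Z^⊥`. -/
  beta : Pt → Pt → ℝ
  hbeta : ∀ X, ∀ p ∈ U, sff ψ conn X ZT p = beta p (X p) • (Z - fderiv ℝ ψ p (ZT p))
  /-- The lightlike normal field `W'` with `⟨Z^⊥, W'⟩ = 1`, such that
  `(Z^⊤, W, (Z^⊥+W')/√2, (Z^⊥−W')/√2)` is a positively oriented orthonormal frame. -/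
  Wp : Pt → E4
  hWpNormal : ∀ p ∈ U, isNormalV ψ p (Wp p)
  hWpNull : ∀ p ∈ U, mink (Wp p) (Wp p) = 0
  hWpPair : ∀ p ∈ U, mink (Z - fderiv ℝ ψ p (ZT p)) (Wp p) = 1
  hWpOrient : ∀ p ∈ U, 0 < det4 (fderiv ℝ ψ p (ZT p)) (fderiv ℝ ψ p (Wc p))
    ((Real.sqrt 2)⁻¹ • ((Z - fderiv ℝ ψ p (ZT p)) + Wp p))
    ((Real.sqrt 2)⁻¹ • ((Z - fderiv ℝ ψ p (ZT p)) - Wp p))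

namespace CNND

variable (S : CNND)

/-- The normal part `Z^⊥` of `Z` along the surface. -/
def Zperp : Pt → E4 := fun p => S.Z - fderiv ℝ S.ψ p (S.ZT p)

/-- The second fundamental form of the surface. -/
def B : (Pt → Pt) → (Pt → Pt) → Pt → E4 := sff S.ψ S.conn

/-- The function `a = α(W) = ⟨B(W,W), Z^⊥⟩`. -/
def afun : Pt → ℝ := fun p => mink (S.B S.Wc S.Wc p) (S.Zperp p)

/-- The 1-form `α(X) = ⟨B(X,W), Z^⊥⟩`. -/
def alphaF (X : Pt → Pt) : Pt → ℝ := fun p => mink (S.B X S.Wc p) (S.Zperp p)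

/-- The mean curvature vector `H⃗ = (1/2)(B(Z^⊤,Z^⊤) + B(W,W))`. -/
def Hvec : Pt → E4 := fun p => (1 / 2 : ℝ) • (S.B S.ZT S.ZT p + S.B S.Wc S.Wc p)

/-- The Gauss curvature `K = ⟨R(Z^⊤,W)Z^⊤, W⟩`. -/
def Kfun : Pt → ℝ := fun p =>
  mink (fderiv ℝ S.ψ p (curvR S.conn S.ZT S.Wc S.ZT p)) (fderiv ℝ S.ψ p (S.Wc p))

/-- The normal curvature `K_N = ⟨R^⊥(Z^⊤,W)Z^⊥, W'⟩`. -/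
def KNfun : Pt → ℝ := fun p => mink (curvRperp S.nconn S.ZT S.Wc S.Zperp p) (S.Wp p)

end CNND

/-- The wedge `v ∧ w` of two vectors of `ℝ⁴`, as an antisymmetric matrix (bivector). -/
def wedge2 (v w : E4) : Fin 4 → Fin 4 → ℝ := fun i j => v i * w j - v j * w i

/-- The Gauss map `G = Z^⊤ ∧ W : M → Λ²ℝ^{3,1}`. -/
def CNND.Gmap (S : CNND) : Pt → Fin 4 → Fin 4 → ℝ :=
  fun p => wedge2 (fderiv ℝ S.ψ p (S.ZT p)) (fderiv ℝ S.ψ p (S.Wc p))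

/-- The signs of the Minkowski metric. -/
def epsM : Fin 4 → ℝ := fun i => if i = 3 then -1 else 1

/-- The induced (signature `(3,3)`) inner product on bivectors of `ℝ^{3,1}`:
`⟨v∧w, v'∧w'⟩ = ⟨v,v'⟩⟨w,w'⟩ − ⟨v,w'⟩⟨w,v'⟩`. -/
def binner (η η' : Fin 4 → Fin 4 → ℝ) : ℝ :=
  (1 / 2) * ∑ i : Fin 4, ∑ j : Fin 4, epsM i * epsM j * η i j * η' i j

/-- The wedge product `Λ²ℝ^{3,1} × Λ²ℝ^{3,1} → Λ⁴ℝ^{3,1} ≅ ℝ`, normalized so that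
`(v∧w)∧(v'∧w') = det(v,w,v',w')`. -/
def bwedge (η η' : Fin 4 → Fin 4 → ℝ) : ℝ :=
  (1 / 4) * ∑ σ : Equiv.Perm (Fin 4),
    ((Equiv.Perm.sign σ : ℤ) : ℝ) * η (σ 0) (σ 1) * η' (σ 2) (σ 3)

/-- The `ℂ`-bilinear form `H(η,η') = ⟨η,η'⟩ + i η∧η'` on bivectors, where `i = −⋆`. -/
def HformC (η η' : Fin 4 → Fin 4 → ℝ) : ℂ :=
  (binner η η' : ℝ) + (bwedge η η' : ℝ) * Complex.I

/-- The quadratic form `δ(u) = dG(u) ∧ dG(u)` whose zero directions are the asymptotic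
directions. -/
def CNND.deltaQ (S : CNND) (p : Pt) (u : Pt) : ℝ :=
  bwedge (fderiv ℝ S.Gmap p u) (fderiv ℝ S.Gmap p u)

lemma mink_comm (v w : E4) : mink v w = mink w v := by
  simp only [mink]; ring

lemma mink_add_left (u v w : E4) : mink (u + v) w = mink u w + mink v w := by
  simp only [mink, Pi.add_apply]; ring

lemma mink_sub_left (u v w : E4) : mink (u - v) w = mink u w - mink v w := by
  simp only [mink, Pi.sub_apply]; ring

lemma mink_smul_left (c : ℝ) (v w : E4) : mink (c • v) w = c * mink v w := by
  simp only [mink, Pi.smul_apply, smul_eq_mul]; ring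

lemma differentiableAt_mink {V W : Pt → E4} {p : Pt} (hV : DifferentiableAt ℝ V p)
    (hW : DifferentiableAt ℝ W p) : DifferentiableAt ℝ (fun q => mink (V q) (W q)) p := by
  have hV' := differentiableAt_pi.1 hV
  have hW' := differentiableAt_pi.1 hW
  exact ((((hV' 0).mul (hW' 0)).add ((hV' 1).mul (hW' 1))).add ((hV' 2).mul (hW' 2))).sub
    ((hV' 3).mul (hW' 3))

lemma fderiv_mink {V W : Pt → E4} {p : Pt} (hV : DifferentiableAt ℝ V p)
    (hW : DifferentiableAt ℝ W p) (x : Pt) :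
    fderiv ℝ (fun q => mink (V q) (W q)) p x =
      mink (fderiv ℝ V p x) (W p) + mink (V p) (fderiv ℝ W p x) := by
  have hV' := hasFDerivAt_pi'.1 hV.hasFDerivAt
  have hW' := hasFDerivAt_pi'.1 hW.hasFDerivAt
  have h := ((((hV' 0).mul (hW' 0)).add ((hV' 1).mul (hW' 1))).add ((hV' 2).mul (hW' 2))).sub
    ((hV' 3).mul (hW' 3))
  have h' : HasFDerivAt (fun q => mink (V q) (W q)) _ p := h
  rw [h'.fderiv]
  simp [mink]
  ring

/-- Differentiating a scalar product that is constant on an open set. -/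
lemma mink_fderiv_eq_neg_of_const {V W : Pt → E4} {U : Set Pt} (hU : IsOpen U) {p : Pt}
    (hp : p ∈ U) (hV : DifferentiableAt ℝ V p) (hW : DifferentiableAt ℝ W p) {c : ℝ}
    (hc : ∀ q ∈ U, mink (V q) (W q) = c) (x : Pt) :
    mink (fderiv ℝ V p x) (W p) = -mink (V p) (fderiv ℝ W p x) := by
  have h : (fun q => mink (V q) (W q)) =ᶠ[nhds p] fun _ => c :=
    Filter.eventually_of_mem (hU.mem_nhds hp) hc
  have h2 := fderiv_mink hV hW x
  rw [h.fderiv_eq, fderiv_fun_const] at h2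
  simp only [Pi.zero_apply, zero_apply] at h2
  linarith

namespace CNND

variable (S : CNND)

lemma vecF_contDiffOn {X : Pt → Pt} (hX : ContDiffOn ℝ (⊤ : ℕ∞) X S.U) :
    ContDiffOn ℝ (⊤ : ℕ∞) (vecF S.ψ X) S.U :=
  (S.hψ.fderiv_of_isOpen S.hUopen (by simp)).clm_apply hX

lemma differentiableAt_of_contDiffOn {F : Type*} [NormedAddCommGroup F] [NormedSpace ℝ F]
    {f : Pt → F} (hf : ContDiffOn ℝ (⊤ : ℕ∞) f S.U) {p : Pt} (hp : p ∈ S.U) :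
    DifferentiableAt ℝ f p :=
  (hf.contDiffAt (S.hUopen.mem_nhds hp)).differentiableAt (by simp)

lemma vecF_differentiableAt {X : Pt → Pt} (hX : ContDiffOn ℝ (⊤ : ℕ∞) X S.U) {p : Pt}
    (hp : p ∈ S.U) : DifferentiableAt ℝ (vecF S.ψ X) p :=
  S.differentiableAt_of_contDiffOn (S.vecF_contDiffOn hX) hp

lemma Zperp_contDiffOn : ContDiffOn ℝ (⊤ : ℕ∞) S.Zperp S.U :=
  contDiffOn_const.sub (S.vecF_contDiffOn S.hZTsmooth)

lemma Zperp_differentiableAt {p : Pt} (hp : p ∈ S.U) : DifferentiableAt ℝ S.Zperp p :=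
  S.differentiableAt_of_contDiffOn S.Zperp_contDiffOn hp

lemma fderiv_Zperp (p x : Pt) : fderiv ℝ S.Zperp p x = -fderiv ℝ (vecF S.ψ S.ZT) p x := by
  have h : S.Zperp = fun q => S.Z - vecF S.ψ S.ZT q := rfl
  rw [h, fderiv_const_sub]
  rfl

lemma mink_ZT_ZT {p : Pt} (hp : p ∈ S.U) : mink (vecF S.ψ S.ZT p) (vecF S.ψ S.ZT p) = 1 := by
  have h1 := S.hZTtangentpart p hp (S.ZT p)
  have h2 := S.hZperpNull p hp
  have h3 := S.hZunit
  simp only [mink, Pi.sub_apply, vecF] at *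
  linarith

/-- A vector that is both tangent and normal to the surface vanishes. -/
lemma eq_zero_of_tangent_of_normal {p : Pt} (hp : p ∈ S.U) {v : E4}
    (ht : isTangentV S.ψ p v) (hn : isNormalV S.ψ p v) : v = 0 := by
  obtain ⟨w, rfl⟩ := ht
  by_cases hw : w = 0
  · simp [hw]
  · exact absurd (hn w) (S.hspacelike p hp w hw).ne'

lemma eq_smul_W_of_mink_ZT_eq_zero {p : Pt} (hp : p ∈ S.U) {v : Pt}
    (hv : mink (fderiv ℝ S.ψ p v) (vecF S.ψ S.ZT p) = 0) :
    ∃ b : ℝ, fderiv ℝ S.ψ p v = b • vecF S.ψ S.Wc p := by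
  set D := (S.ZT p).1 * (S.Wc p).2 - (S.ZT p).2 * (S.Wc p).1 with hD
  have hD0 : D ≠ 0 := (S.hWorient p hp).ne'
  obtain ⟨a, b, hab⟩ : ∃ a b : ℝ, v = a • S.ZT p + b • S.Wc p := by
    refine ⟨(v.1 * (S.Wc p).2 - v.2 * (S.Wc p).1) / D,
      ((S.ZT p).1 * v.2 - (S.ZT p).2 * v.1) / D, ?_⟩
    ext
    · simp only [Prod.fst_add, Prod.smul_fst, smul_eq_mul]
      field_simp
      rw [hD]; ring
    · simp only [Prod.snd_add, Prod.smul_snd, smul_eq_mul]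
      field_simp
      rw [hD]; ring
  have hv' : fderiv ℝ S.ψ p v = a • vecF S.ψ S.ZT p + b • vecF S.ψ S.Wc p := by
    simp [hab, vecF]
  have h1 := S.mink_ZT_ZT hp
  have h2 : mink (vecF S.ψ S.Wc p) (vecF S.ψ S.ZT p) = 0 := by
    rw [mink_comm]; exact S.hWorth p hp
  rw [hv', mink_add_left, mink_smul_left, mink_smul_left, h1, h2] at hv
  have ha : a = 0 := by linarith
  exact ⟨b, by rw [hv', ha, zero_smul, zero_add]⟩

/-- The Levi-Civita derivative and the flat derivative have the same tangent components. -/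
lemma mink_conn {X Y : Pt → Pt} {p : Pt} (hp : p ∈ S.U)
    (hY : DifferentiableAt ℝ (vecF S.ψ Y) p) (w : Pt) :
    mink (fderiv ℝ S.ψ p (S.conn X Y p)) (fderiv ℝ S.ψ p w) =
      mink (fderiv ℝ (vecF S.ψ Y) p (X p)) (fderiv ℝ S.ψ p w) := by
  have h := S.hconn X Y p hp hY w
  rw [sff, mink_sub_left] at h
  exact (sub_eq_zero.1 h).symm

lemma mink_fderiv_ZT_ZT {p : Pt} (hp : p ∈ S.U) (x : Pt) :
    mink (fderiv ℝ (vecF S.ψ S.ZT) p x) (vecF S.ψ S.ZT p) = 0 := by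
  have hd := S.vecF_differentiableAt S.hZTsmooth hp
  have h := mink_fderiv_eq_neg_of_const S.hUopen hp hd hd (fun q hq => S.mink_ZT_ZT hq) x
  rw [mink_comm (vecF S.ψ S.ZT p)] at h
  linarith

lemma mink_fderiv_W_W {p : Pt} (hp : p ∈ S.U) (x : Pt) :
    mink (vecF S.ψ S.Wc p) (fderiv ℝ (vecF S.ψ S.Wc) p x) = 0 := by
  have hd := S.vecF_differentiableAt S.hWsmooth hp
  have h := mink_fderiv_eq_neg_of_const S.hUopen hp hd hd (fun q hq => S.hWunit q hq) x
  rw [mink_comm] at h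
  linarith

/-- `α` is the connection form of the orthonormal frame `(Z^⊤, W)`. -/
lemma alphaF_eq {X : Pt → Pt} {p : Pt} (hp : p ∈ S.U) :
    S.alphaF X p = mink (fderiv ℝ (vecF S.ψ S.ZT) p (X p)) (vecF S.ψ S.Wc p) := by
  have h1 : mink (vecF S.ψ (S.conn X S.Wc) p) (S.Zperp p) = 0 := by
    rw [mink_comm]; exact S.hZTtangentpart p hp _
  have h2 := mink_fderiv_eq_neg_of_const S.hUopen hp (S.Zperp_differentiableAt hp)
    (S.vecF_differentiableAt S.hWsmooth hp) (fun q hq => S.hZTtangentpart q hq (S.Wc q)) (X p)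
  rw [S.fderiv_Zperp, ← neg_one_smul ℝ, mink_smul_left, mink_comm (S.Zperp p)] at h2
  rw [alphaF, B, sff, mink_sub_left, h1, Dflat]
  linarith

/-- `⟨∇_Y ∇_X Z^⊤, W⟩ = Y(α(X))`. -/
lemma mink_conn_conn_ZT {X Y : Pt → Pt} (hX : ContDiffOn ℝ (⊤ : ℕ∞) X S.U) {p : Pt}
    (hp : p ∈ S.U) :
    mink (fderiv ℝ S.ψ p (S.conn Y (S.conn X S.ZT) p)) (fderiv ℝ S.ψ p (S.Wc p)) =
      fderiv ℝ (S.alphaF X) p (Y p) := by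
  have hd : DifferentiableAt ℝ (vecF S.ψ (S.conn X S.ZT)) p :=
    S.vecF_differentiableAt (S.hconnSmooth X S.ZT hX S.hZTsmooth) hp
  have hα : S.alphaF X =ᶠ[nhds p]
      fun q => mink (vecF S.ψ (S.conn X S.ZT) q) (vecF S.ψ S.Wc q) := by
    refine Filter.eventually_of_mem (S.hUopen.mem_nhds hp) fun q hq => ?_
    simp only
    rw [S.alphaF_eq hq]
    exact (S.mink_conn hq (S.vecF_differentiableAt S.hZTsmooth hq) _).symm
  have hpar : mink (fderiv ℝ S.ψ p (S.conn X S.ZT p)) (vecF S.ψ S.ZT p) = 0 :=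
    (S.mink_conn hp (S.vecF_differentiableAt S.hZTsmooth hp) _).trans
      (S.mink_fderiv_ZT_ZT hp _)
  obtain ⟨b, hb⟩ := S.eq_smul_W_of_mink_ZT_eq_zero hp hpar
  have hb' : vecF S.ψ (S.conn X S.ZT) p = b • vecF S.ψ S.Wc p := hb
  rw [S.mink_conn hp hd, hα.fderiv_eq, fderiv_mink hd (S.vecF_differentiableAt S.hWsmooth hp),
    hb', mink_smul_left, S.mink_fderiv_W_W hp, mul_zero, add_zero]
  rfl

/-- `∇⊥_X Z^⊥ = -β(X) Z^⊥`. -/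
lemma nconn_Zperp (X : Pt → Pt) {p : Pt} (hp : p ∈ S.U) :
    S.nconn X S.Zperp p = -S.beta p (X p) • S.Zperp p := by
  obtain ⟨hn, w, hw⟩ := S.hnconn X S.Zperp p hp S.hZTtangentpart (S.Zperp_differentiableAt hp)
  have hβ : fderiv ℝ (vecF S.ψ S.ZT) p (X p) - fderiv ℝ S.ψ p (S.conn X S.ZT p) =
      S.beta p (X p) • S.Zperp p := S.hbeta X p hp
  rw [Dflat, S.fderiv_Zperp] at hw
  have h0 : S.nconn X S.Zperp p + S.beta p (X p) • S.Zperp p = 0 := by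
    refine S.eq_zero_of_tangent_of_normal hp ⟨-w - S.conn X S.ZT p, ?_⟩ fun u => ?_
    · rw [map_sub, map_neg, hw, ← hβ]
      abel
    · have hZ : mink (S.Zperp p) (fderiv ℝ S.ψ p u) = 0 := S.hZTtangentpart p hp u
      rw [mink_add_left, mink_smul_left, hn u, hZ, mul_zero, add_zero]
  rw [neg_smul]
  exact eq_neg_of_add_eq_zero_left h0

lemma beta_differentiableAt {X : Pt → Pt} (hX : ContDiffOn ℝ (⊤ : ℕ∞) X S.U) {p : Pt}
    (hp : p ∈ S.U) : DifferentiableAt ℝ (fun q => S.beta q (X q)) p := by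
  have hν := S.differentiableAt_of_contDiffOn
    (S.hnconnSmooth X S.Zperp hX S.hZTtangentpart S.Zperp_contDiffOn) hp
  have hZ := S.Zperp_differentiableAt hp
  have hc : DifferentiableAt ℝ (fun _ : Pt => S.Wp p) p := differentiableAt_const _
  have hd := differentiableAt_mink hZ hc
  have hne : mink (S.Zperp p) (S.Wp p) ≠ 0 := by
    rw [show mink (S.Zperp p) (S.Wp p) = 1 from S.hWpPair p hp]; exact one_ne_zero
  have hdiv : DifferentiableAt ℝ
      (fun q => -mink (S.nconn X S.Zperp q) (S.Wp p) * (mink (S.Zperp q) (S.Wp p))⁻¹) p :=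
    (differentiableAt_mink hν hc).fun_neg.fun_mul (hd.fun_inv hne)
  refine hdiv.congr_of_eventuallyEq ?_
  filter_upwards [S.hUopen.mem_nhds hp, hd.continuousAt.eventually_ne hne] with q hq hq0
  rw [S.nconn_Zperp X hq, mink_smul_left]
  field_simp

/-- `⟨∇⊥_Y ∇⊥_X Z^⊥, W'⟩ = -Y(β(X)) + β(X) β(Y)`. -/
lemma mink_nconn_nconn_Zperp {X Y : Pt → Pt} (hX : ContDiffOn ℝ (⊤ : ℕ∞) X S.U) {p : Pt}
    (hp : p ∈ S.U) :
    mink (S.nconn Y (S.nconn X S.Zperp) p) (S.Wp p) =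
      -fderiv ℝ (fun q => S.beta q (X q)) p (Y p) + S.beta p (X p) * S.beta p (Y p) := by
  have hpair : mink (S.Zperp p) (S.Wp p) = 1 := S.hWpPair p hp
  have hmink : ∀ ν : Pt → E4, (∀ q ∈ S.U, isNormalV S.ψ q (ν q)) → DifferentiableAt ℝ ν p →
      mink (fderiv ℝ ν p (Y p)) (S.Wp p) = mink (S.nconn Y ν p) (S.Wp p) := by
    intro ν hν hνd
    obtain ⟨-, w, hw⟩ := S.hnconn Y ν p hp hν hνd
    have h : mink (fderiv ℝ S.ψ p w) (S.Wp p) = 0 := by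
      rw [mink_comm]; exact S.hWpNormal p hp w
    rw [hw, mink_sub_left] at h
    exact sub_eq_zero.1 h
  have hZ := hmink S.Zperp S.hZTtangentpart (S.Zperp_differentiableAt hp)
  rw [S.nconn_Zperp Y hp, mink_smul_left, hpair] at hZ
  have hν : S.nconn X S.Zperp =ᶠ[nhds p] fun q => -S.beta q (X q) • S.Zperp q :=
    Filter.eventually_of_mem (S.hUopen.mem_nhds hp) fun q hq => S.nconn_Zperp X hq
  rw [← hmink _
    (fun q hq => (S.hnconn X S.Zperp q hq S.hZTtangentpart (S.Zperp_differentiableAt hq)).1)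
    (S.differentiableAt_of_contDiffOn
      (S.hnconnSmooth X S.Zperp hX S.hZTtangentpart S.Zperp_contDiffOn) hp), hν.fderiv_eq,
    fderiv_fun_smul (S.beta_differentiableAt hX hp).fun_neg (S.Zperp_differentiableAt hp),
    fderiv_fun_neg]
  simp only [add_apply, smul_apply,
    ContinuousLinearMap.smulRight_apply, neg_apply, mink_add_left,
    mink_smul_left, hZ, hpair]
  ring

end CNND

/-- The Gauss curvature and the normal curvature of `M` are given by the
exterior derivatives `K = −dα(Z^⊤, W)` and `K_N = dβ(Z^⊤, W)`, where
`dω(X,Y) = X(ω(Y)) − Y(ω(X)) − ω([X,Y])`. -/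
theorem cnnd_curvatures_as_exterior_derivatives (S : CNND) :
    ∀ p ∈ S.U,
      S.Kfun p =
        -(fderiv ℝ (S.alphaF S.Wc) p (S.ZT p) - fderiv ℝ (S.alphaF S.ZT) p (S.Wc p) -
          S.alphaF (lieB S.ZT S.Wc) p) ∧
      S.KNfun p =
        fderiv ℝ (fun q => S.beta q (S.Wc q)) p (S.ZT p) -
          fderiv ℝ (fun q => S.beta q (S.ZT q)) p (S.Wc p) -
          S.beta p (lieB S.ZT S.Wc p) := by
  intro p hp
  constructor
  · have h := S.mink_conn (X := lieB S.ZT S.Wc) hp (S.vecF_differentiableAt S.hZTsmooth hp)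
      (S.Wc p)
    rw [CNND.Kfun, curvR, map_add, map_sub, mink_add_left, mink_sub_left,
      S.mink_conn_conn_ZT S.hZTsmooth hp, S.mink_conn_conn_ZT S.hWsmooth hp, h, S.alphaF_eq hp]
    simp only [vecF]
    ring
  · have hpair : mink (S.Zperp p) (S.Wp p) = 1 := S.hWpPair p hp
    rw [CNND.KNfun, curvRperp, mink_add_left, mink_sub_left,
      S.mink_nconn_nconn_Zperp S.hZTsmooth hp, S.mink_nconn_nconn_Zperp S.hWsmooth hp,
      S.nconn_Zperp _ hp, mink_smul_left, hpair]
    ring
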